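/- Let T be a continuous bundle random dynamical system on E over (Ω,F,P,ϑ) with (T_ω^k)^{-1}x ≠ ∅ for all k and x ∈ X_E, f ∈ L^1_E(Ω,C(X)), and m ∈ ℕ_+. Then for every ε > 0, P_pre(T^m, S_m f, ε) ≤ m · P_pre(T, f, ε); in particular P_pre(T^m, S_m f) ≤ m · P_pre(T, f). -/

import Mathlib

open MeasureTheory Filter Set

namespace PreImageRDS

variable {Ω : Type} [MeasurableSpace Ω] {X : Type} [MetricSpace X] [CompactSpace X]
  [MeasurableSpace X] [BorelSpace X]

/-- The fiber `E_ω = {x : (ω, x) ∈ E}`. -/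
def fiber (E : Set (Ω × X)) (ω : Ω) : Set X := {x | (ω, x) ∈ E}

/-- `X_E = {x : (ω, x) ∈ E for some ω}`. -/
def XE (E : Set (Ω × X)) : Set X := {x | ∃ ω, (ω, x) ∈ E}

/-- The iterates `T_ω^n = T_{ϑ^{n-1}ω} ∘ ⋯ ∘ T_{ϑω} ∘ T_ω`. -/
def Tn (ϑ : Ω → Ω) (T : Ω → X → X) : ℕ → Ω → X → X
  | 0 => fun _ x => x
  | n + 1 => fun ω x => Tn ϑ T n (ϑ ω) (T ω x)

/-- The skew product `Θ(ω,x) = (ϑω, T_ω x)`. -/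
def skew (ϑ : Ω → Ω) (T : Ω → X → X) : Ω × X → Ω × X := fun p => (ϑ p.1, T p.1 p.2)

/-- The Bowen metric `d_n^ω(y,z) = max_{0 ≤ i < n} d(T_ω^i y, T_ω^i z)`. -/
noncomputable def dn (ϑ : Ω → Ω) (T : Ω → X → X) (n : ℕ) (ω : Ω) (y z : X) : ℝ :=
  ((Finset.range n).sup fun i => nndist (Tn ϑ T i ω y) (Tn ϑ T i ω z) : NNReal)

/-- `F` is `(ω,n,ε)`-separated. -/
def IsSep (ϑ : Ω → Ω) (T : Ω → X → X) (n : ℕ) (ε : ℝ) (ω : Ω) (F : Set X) : Prop :=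
  ∀ y ∈ F, ∀ z ∈ F, y ≠ z → ε < dn ϑ T n ω y z

/-- The pre-image fiber `(T_ω^k)^{-1} x ⊆ E_ω`. -/
def preFiber (ϑ : Ω → Ω) (T : Ω → X → X) (E : Set (Ω × X)) (k : ℕ) (x : X) (ω : Ω) :
    Set X :=
  {y ∈ fiber E ω | Tn ϑ T k ω y = x}

/-- The Birkhoff sum `S_n f(ω,y) = ∑_{i<n} f(ϑ^i ω, T_ω^i y)`. -/
noncomputable def Snf (ϑ : Ω → Ω) (T : Ω → X → X) (f : Ω → X → ℝ) (n : ℕ) (ω : Ω)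
    (y : X) : ℝ :=
  ∑ i ∈ Finset.range n, f (ϑ^[i] ω) (Tn ϑ T i ω y)

/-- `P_{pre,n,ω}(T,f,ε,(T_ω^k)^{-1}x)`. -/
noncomputable def PpreN (ϑ : Ω → Ω) (T : Ω → X → X) (E : Set (Ω × X)) (f : Ω → X → ℝ)
    (n k : ℕ) (ε : ℝ) (x : X) (ω : Ω) : ℝ :=
  sSup {r : ℝ | ∃ F : Finset X, ↑F ⊆ preFiber ϑ T E k x ω ∧ IsSep ϑ T n ε ω ↑F ∧
    r = ∑ y ∈ F, Real.exp (Snf ϑ T f n ω y)}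

/-- `P_pre(T,f,ε)`. -/
noncomputable def PpreEps (P : Measure Ω) (ϑ : Ω → Ω) (T : Ω → X → X) (E : Set (Ω × X))
    (f : Ω → X → ℝ) (ε : ℝ) : ℝ :=
  limsup (fun n : ℕ => (1 / (n : ℝ)) *
    sSup {r : ℝ | ∃ k ≥ n, ∃ x ∈ XE E,
      r = ∫ ω, Real.log (PpreN ϑ T E f n k ε x ω) ∂P}) atTop

/-- The pre-image topological pressure `P_pre(T,f) = lim_{ε→0} P_pre(T,f,ε)
    (`= sup_{ε>0} P_pre(T,f,ε)` by monotonicity in `ε`). -/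
noncomputable def Ppre (P : Measure Ω) (ϑ : Ω → Ω) (T : Ω → X → X) (E : Set (Ω × X))
    (f : Ω → X → ℝ) : ℝ :=
  sSup {r : ℝ | ∃ ε > (0 : ℝ), r = PpreEps P ϑ T E f ε}

/-- The σ-algebra `F_E` (sets depending only on ω). -/
def mF (Ω X : Type) [MeasurableSpace Ω] [MeasurableSpace X] : MeasurableSpace (Ω × X) :=
  MeasurableSpace.comap Prod.fst inferInstance

/-- The σ-algebra `(F×B)^-_E = ⋂_{n ≥ 0} Θ^{-n}(F×B)_E`. -/
def mMinus (ϑ : Ω → Ω) (T : Ω → X → X) : MeasurableSpace (Ω × X) :=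
  ⨅ n : ℕ, MeasurableSpace.comap ((skew ϑ T)^[n]) inferInstance

/-- The fiberwise σ-algebra `B^-_ω = ⋂_{n ≥ 0}(T_ω^n)^{-1} B_{ϑ^n ω}`. -/
def mMinusFiber (ϑ : Ω → Ω) (T : Ω → X → X) (ω : Ω) : MeasurableSpace X :=
  ⨅ n : ℕ, MeasurableSpace.comap (Tn ϑ T n ω) inferInstance

/-- Conditional entropy `H_μ(Q | m)` of a finite family of sets given a σ-algebra `m`,
    via conditional expectations of indicators. -/
noncomputable def condEntropyFam {α : Type} [MeasurableSpace α] (μ : Measure α)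
    (m : MeasurableSpace α) {ι : Type} [Fintype ι] (Q : ι → Set α) : ℝ :=
  - ∫ a, ∑ i, ((μ[(Q i).indicator (fun _ => (1 : ℝ)) | m]) a) *
      Real.log ((μ[(Q i).indicator (fun _ => (1 : ℝ)) | m]) a) ∂μ

/-- `Q` is a finite measurable partition of `E`. -/
def IsFinPart {α : Type} [MeasurableSpace α] {ι : Type} [Fintype ι] (Q : ι → Set α)
    (E : Set α) : Prop :=
  (∀ i, MeasurableSet (Q i)) ∧ (∀ i j, i ≠ j → Disjoint (Q i) (Q j)) ∧ (⋃ i, Q i) = E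

/-- `h^{(r)}_{pre,μ}(T,Q) = lim_n (1/n) H_μ(⋁_{i<n} Θ^{-i}Q | F_E ∨ (F×B)^-_E)`. -/
noncomputable def hPrePart (ϑ : Ω → Ω) (T : Ω → X → X) (μ : Measure (Ω × X))
    {N : ℕ} (Q : Fin N → Set (Ω × X)) : ℝ :=
  limsup (fun n : ℕ => (1 / (n : ℝ)) * condEntropyFam μ (mF Ω X ⊔ mMinus ϑ T)
    (fun j : Fin n → Fin N => ⋂ i : Fin n, (skew ϑ T)^[(i : ℕ)] ⁻¹' Q (j i))) atTop

/-- The pre-image measure-theoretic entropy `h^{(r)}_{pre,μ}(T)`. -/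
noncomputable def hPre (ϑ : Ω → Ω) (T : Ω → X → X) (E : Set (Ω × X))
    (μ : Measure (Ω × X)) : ℝ :=
  sSup {h : ℝ | ∃ (N : ℕ) (Q : Fin N → Set (Ω × X)), IsFinPart Q E ∧
    h = hPrePart ϑ T μ Q}

/-- `μ ∈ M^1_P(E,T)`: a Θ-invariant probability measure on `E` with marginal `P`. -/
def IsPInv (P : Measure Ω) (ϑ : Ω → Ω) (T : Ω → X → X) (E : Set (Ω × X))
    (μ : Measure (Ω × X)) : Prop :=
  IsProbabilityMeasure μ ∧ μ E = 1 ∧ μ.map Prod.fst = P ∧ μ.map (skew ϑ T) = μ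


set_option linter.unusedSectionVars false

section Analytic
open Topology

lemma isCompact_setOf_forall_le (k : ℕ → ℕ) : IsCompact {x : ℕ → ℕ | ∀ i, x i ≤ k i} := by
  have : {x : ℕ → ℕ | ∀ i, x i ≤ k i} = univ.pi fun i => Iic (k i) := by
    ext; simp [Pi.le_def]
  rw [this]
  exact isCompact_univ_pi fun i => (finite_Iic (k i)).isCompact

/-- A point outside the image of a compact box `∏ [0, k i]` is outside the closure of the image of
one of the sets where only finitely many coordinates are bounded by `k`. -/
lemma iInter_closure_image_le_subset {Z : Type*} [TopologicalSpace Z] [T2Space Z]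
    {g : (ℕ → ℕ) → Z} (hg : Continuous g) (k : ℕ → ℕ) :
    ⋂ n, closure (g '' {x | ∀ i < n, x i ≤ k i}) ⊆ g '' {x | ∀ i, x i ≤ k i} := by
  have hK := isCompact_setOf_forall_le k
  intro z hz
  by_contra hzK
  obtain ⟨U, V, hU, hV, hKU, hzV, hUV⟩ :=
    SeparatedNhds.of_isCompact_isCompact (hK.image hg) (isCompact_singleton (x := z))
      (disjoint_singleton_right.2 hzK)
  have hsub : ∃ n, {x | ∀ i < n, x i ≤ k i} ⊆ g ⁻¹' U := by
    by_contra! hcon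
    simp only [not_subset] at hcon
    choose x hx hxU using hcon
    let x' : ℕ → ℕ → ℕ := fun n i => if i < n then x n i else 0
    have hx' : ∀ n, x' n ∈ {x : ℕ → ℕ | ∀ i, x i ≤ k i} := by
      intro n i
      by_cases h : i < n
      · simpa [x', h] using hx n i h
      · simp [x', h]
    obtain ⟨a, haK, φ, hφ, hlim⟩ := hK.tendsto_subseq hx'
    have hlim' : Tendsto (fun n => x (φ n)) atTop (𝓝 a) := by
      rw [tendsto_pi_nhds] at hlim ⊢
      intro i
      refine (hlim i).congr' ?_
      filter_upwards [eventually_gt_atTop i] with n hn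
      simp [x', hn.trans_le (hφ.id_le n)]
    have haU : a ∈ g ⁻¹' U := hKU (mem_image_of_mem g haK)
    obtain ⟨n, hn⟩ := (hlim'.eventually ((hU.preimage hg).mem_nhds haU)).exists
    exact hxU _ hn
  obtain ⟨n, hn⟩ := hsub
  have hzn := mem_iInter.1 hz n
  obtain ⟨y, hyV, hyn⟩ := mem_closure_iff.1 hzn V hV (hzV rfl)
  exact disjoint_left.1 hUV (image_subset_iff.2 hn hyn) hyV

lemma exists_isCompact_subset_range_le_measure {Z : Type*} [TopologicalSpace Z] [T2Space Z]
    [MeasurableSpace Z] [OpensMeasurableSpace Z] (μ : Measure Z) [IsFiniteMeasure μ]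
    {g : (ℕ → ℕ) → Z} (hg : Continuous g) {c : ENNReal} (hc : c < μ (range g)) :
    ∃ K, IsCompact K ∧ K ⊆ range g ∧ c ≤ μ K := by
  have step : ∀ (S : Set (ℕ → ℕ)) (n : ℕ), c < μ (g '' S) →
      ∃ j, c < μ (g '' (S ∩ {x | x n ≤ j})) := by
    intro S n hS
    have hU : g '' S = ⋃ j, g '' (S ∩ {x | x n ≤ j}) := by
      rw [← image_iUnion, ← inter_iUnion]
      congr 1
      refine (inter_eq_left.2 fun x _ => mem_iUnion.2 ⟨x n, le_refl (x n)⟩).symm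
    have hmono : Monotone fun j => g '' (S ∩ {x | x n ≤ j}) := fun i j hij =>
      image_mono (inter_subset_inter_right _ fun x hx => le_trans hx hij)
    rw [hU, hmono.measure_iUnion] at hS
    exact lt_iSup_iff.1 hS
  choose! next hnext using step
  let S : ℕ → Set (ℕ → ℕ) := fun n =>
    Nat.rec univ (fun n S => S ∩ {x | x n ≤ next S n}) n
  have hS : ∀ n, c < μ (g '' S n) := by
    intro n
    induction n with
    | zero => simpa [S] using hc
    | succ n ih => exact hnext _ n ih
  let k : ℕ → ℕ := fun n => next (S n) n
  have hSk : ∀ n, S n ⊆ {x | ∀ i < n, x i ≤ k i} := by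
    intro n
    induction n with
    | zero => simp
    | succ n ih =>
      intro x hx i hi
      rcases Nat.lt_succ_iff_lt_or_eq.1 hi with h | rfl
      · exact ih hx.1 i h
      · exact hx.2
  have hK := isCompact_setOf_forall_le k
  refine ⟨_, hK.image hg, image_subset_range _ _, ?_⟩
  refine le_trans ?_ (measure_mono (iInter_closure_image_le_subset hg k))
  have hanti : Antitone fun n => closure (g '' {x : ℕ → ℕ | ∀ i < n, x i ≤ k i}) :=
    fun a b hab => closure_mono (image_mono fun x hx i hi => hx i (hi.trans_le hab))
  refine ge_of_tendsto' (tendsto_measure_iInter_atTop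
    (fun n => isClosed_closure.measurableSet.nullMeasurableSet) hanti
    ⟨0, measure_ne_top _ _⟩) fun n => ?_
  exact (hS n).le.trans (measure_mono ((image_mono (hSk n)).trans subset_closure))

/-- Analytic sets are universally measurable. -/
theorem nullMeasurableSet_of_analyticSet {Z : Type*} [TopologicalSpace Z] [T2Space Z]
    [MeasurableSpace Z] [OpensMeasurableSpace Z] (μ : Measure Z) [IsFiniteMeasure μ]
    {A : Set Z} (hA : AnalyticSet A) : NullMeasurableSet A μ := by
  rw [AnalyticSet] at hA
  rcases hA with rfl | ⟨g, hg, rfl⟩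
  · exact MeasurableSet.empty.nullMeasurableSet
  by_cases h0 : μ (range g) = 0
  · exact NullMeasurableSet.of_null h0
  obtain ⟨c, -, hc, hlim⟩ := exists_seq_strictMono_tendsto' (pos_iff_ne_zero.2 h0)
  choose K hK hKg hcK using fun n =>
    exists_isCompact_subset_range_le_measure μ hg (hc n).2
  have hm : NullMeasurableSet (⋃ n, K n) μ :=
    (MeasurableSet.iUnion fun n => (hK n).isClosed.measurableSet).nullMeasurableSet
  refine hm.congr (ae_eq_of_subset_of_measure_ge (iUnion_subset hKg) ?_ hm (measure_ne_top _ _))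
  exact le_of_tendsto' hlim fun n => (hcK n).trans (measure_mono (subset_iUnion K n))

lemma exists_measurableSet_prodMap_mapNatBool_preimage {α Y : Type*} [MeasurableSpace α]
    [MeasurableSpace.CountablyGenerated α] [MeasurableSpace Y] {s : Set (α × Y)}
    (hs : MeasurableSet s) :
    ∃ t : Set ((ℕ → Bool) × Y), MeasurableSet t ∧
      Prod.map (MeasurableSpace.mapNatBool α) id ⁻¹' t = s := by
  have hcomap : ‹MeasurableSpace α› =
      MeasurableSpace.comap (MeasurableSpace.mapNatBool α) inferInstance := by
    refine le_antisymm ?_ (MeasurableSpace.measurable_mapNatBool α).comap_le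
    conv_lhs => rw [← MeasurableSpace.generateFrom_natGeneratingSequence α]
    refine MeasurableSpace.generateFrom_le ?_
    rintro _ ⟨n, rfl⟩
    refine ⟨(fun y => y n) ⁻¹' {true}, measurable_pi_apply n (MeasurableSet.singleton true), ?_⟩
    ext x
    simp [MeasurableSpace.mapNatBool]
  have hle : (inferInstance : MeasurableSpace (α × Y)) ≤
      MeasurableSpace.comap (Prod.map (MeasurableSpace.mapNatBool α) id)
        (inferInstance : MeasurableSpace ((ℕ → Bool) × Y)) := by
    refine sup_le ?_ ?_
    · conv_lhs => rw [hcomap]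
      rw [MeasurableSpace.comap_comp]
      exact (measurable_fst.comp (comap_measurable
        (Prod.map (MeasurableSpace.mapNatBool α) (id : Y → Y)))).comap_le
    · exact (measurable_snd.comp (comap_measurable
        (Prod.map (MeasurableSpace.mapNatBool α) (id : Y → Y)))).comap_le
  exact hle s hs

/-- The measurable projection theorem, in the form of null-measurability. -/
theorem nullMeasurableSet_image_fst {α Y : Type*} [MeasurableSpace α]
    [MeasurableSpace.CountablyGenerated α] [MeasurableSpace Y] [StandardBorelSpace Y]
    (μ : Measure α) [IsFiniteMeasure μ] {s : Set (α × Y)} (hs : MeasurableSet s) :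
    NullMeasurableSet (Prod.fst '' s) μ := by
  obtain ⟨t, ht, rfl⟩ := exists_measurableSet_prodMap_mapNatBool_preimage hs
  have hφ := MeasurableSpace.measurable_mapNatBool α
  have himg : Prod.fst '' (Prod.map (MeasurableSpace.mapNatBool α) id ⁻¹' t) =
      MeasurableSpace.mapNatBool α ⁻¹' (Prod.fst '' t) := by
    ext a
    simp
  rw [himg]
  have := nullMeasurableSet_of_analyticSet (μ.map (MeasurableSpace.mapNatBool α))
    (ht.analyticSet_image measurable_fst)
  exact this.preimage (hφ.quasiMeasurePreserving μ)

end Analytic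

section Iterates

lemma Tn_add (ϑ : Ω → Ω) (T : Ω → X → X) (a b : ℕ) (ω : Ω) (x : X) :
    Tn ϑ T (a + b) ω x = Tn ϑ T b (ϑ^[a] ω) (Tn ϑ T a ω x) := by
  induction a generalizing ω x with
  | zero => simp [Tn]
  | succ a ih =>
    rw [Nat.succ_add]
    simp [Tn, ih]

lemma Tn_iterate (ϑ : Ω → Ω) (T : Ω → X → X) (m n : ℕ) (ω : Ω) (x : X) :
    Tn (ϑ^[m]) (fun ω => Tn ϑ T m ω) n ω x = Tn ϑ T (m * n) ω x := by
  induction n generalizing ω x with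
  | zero => simp [Tn]
  | succ n ih =>
    change Tn (ϑ^[m]) (fun ω => Tn ϑ T m ω) n (ϑ^[m] ω) (Tn ϑ T m ω x) = _
    rw [ih, ← Tn_add, Nat.mul_succ, Nat.add_comm]

lemma Snf_add (ϑ : Ω → Ω) (T : Ω → X → X) (f : Ω → X → ℝ) (a b : ℕ) (ω : Ω) (x : X) :
    Snf ϑ T f (a + b) ω x = Snf ϑ T f a ω x + Snf ϑ T f b (ϑ^[a] ω) (Tn ϑ T a ω x) := by
  unfold Snf
  rw [Finset.sum_range_add]
  congr 1
  refine Finset.sum_congr rfl fun i _ => ?_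
  rw [Tn_add, Nat.add_comm, Function.iterate_add_apply]

lemma Snf_iterate (ϑ : Ω → Ω) (T : Ω → X → X) (f : Ω → X → ℝ) (m n : ℕ) (ω : Ω) (x : X) :
    Snf (ϑ^[m]) (fun ω => Tn ϑ T m ω) (fun ω => Snf ϑ T f m ω) n ω x =
      Snf ϑ T f (m * n) ω x := by
  induction n with
  | zero => simp [Snf]
  | succ n ih =>
    rw [Nat.mul_succ, Snf_add ϑ, ← ih, Function.iterate_mul, ← Tn_iterate]
    exact Finset.sum_range_succ _ n

lemma preFiber_iterate (ϑ : Ω → Ω) (T : Ω → X → X) (E : Set (Ω × X)) (m k : ℕ) (x : X) (ω : Ω) :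
    preFiber (ϑ^[m]) (fun ω => Tn ϑ T m ω) E k x ω = preFiber ϑ T E (m * k) x ω := by
  simp only [preFiber, Tn_iterate]

lemma lt_dn_iff {ϑ : Ω → Ω} {T : Ω → X → X} {n : ℕ} {ω : Ω} {y z : X} {ε : ℝ} (hε : 0 ≤ ε) :
    ε < dn ϑ T n ω y z ↔ ∃ i < n, ε < dist (Tn ϑ T i ω y) (Tn ϑ T i ω z) := by
  lift ε to NNReal using hε
  simp only [dn, NNReal.coe_lt_coe, Finset.lt_sup_iff, Finset.mem_range, ← coe_nndist]

lemma IsSep.of_iterate {ϑ : Ω → Ω} {T : Ω → X → X} {m n : ℕ} {ε : ℝ} (hm : 0 < m) (hε : 0 ≤ ε)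
    {ω : Ω} {F : Set X} (h : IsSep (ϑ^[m]) (fun ω => Tn ϑ T m ω) n ε ω F) :
    IsSep ϑ T (m * n) ε ω F := by
  intro y hy z hz hyz
  obtain ⟨i, hi, hd⟩ := (lt_dn_iff hε).1 (h y hy z hz hyz)
  simp only [Tn_iterate] at hd
  exact (lt_dn_iff hε).2 ⟨m * i, Nat.mul_lt_mul_of_pos_left hi hm, hd⟩

lemma isSep_singleton (ϑ : Ω → Ω) (T : Ω → X → X) (n : ℕ) (ε : ℝ) (ω : Ω) (y : X) :
    IsSep ϑ T n ε ω {y} := by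
  rintro a rfl b rfl h
  exact absurd rfl h

lemma mapsTo_Tn {ϑ : Ω → Ω} {T : Ω → X → X} {E : Set (Ω × X)}
    (hT : ∀ ω, MapsTo (T ω) (fiber E ω) (fiber E (ϑ ω))) (n : ℕ) (ω : Ω) :
    MapsTo (Tn ϑ T n ω) (fiber E ω) (fiber E (ϑ^[n] ω)) := by
  induction n generalizing ω with
  | zero => exact fun x hx => hx
  | succ n ih => exact fun x hx => ih (ϑ ω) (hT ω hx)

lemma continuousOn_Tn {ϑ : Ω → Ω} {T : Ω → X → X} {E : Set (Ω × X)}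
    (hT : ∀ ω, MapsTo (T ω) (fiber E ω) (fiber E (ϑ ω))) {ω : Ω}
    (hc : ∀ i, ContinuousOn (T (ϑ^[i] ω)) (fiber E (ϑ^[i] ω))) (n : ℕ) :
    ContinuousOn (Tn ϑ T n ω) (fiber E ω) := by
  induction n generalizing ω with
  | zero => exact continuousOn_id
  | succ n ih => exact (ih fun i => hc (i + 1)).comp (hc 0) (hT ω)

lemma measurable_skew {ϑ : Ω → Ω} {T : Ω → X → X} (hϑ : Measurable ϑ)
    (hT : Measurable fun p : Ω × X => T p.1 p.2) : Measurable (skew ϑ T) :=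
  (hϑ.comp measurable_fst).prodMk hT

lemma measurable_Tn {ϑ : Ω → Ω} {T : Ω → X → X} (hϑ : Measurable ϑ)
    (hT : Measurable fun p : Ω × X => T p.1 p.2) (n : ℕ) :
    Measurable fun p : Ω × X => Tn ϑ T n p.1 p.2 := by
  induction n with
  | zero => exact measurable_snd
  | succ n ih => exact ih.comp (measurable_skew hϑ hT)

lemma measurable_Snf {ϑ : Ω → Ω} {T : Ω → X → X} {f : Ω → X → ℝ} (hϑ : Measurable ϑ)
    (hT : Measurable fun p : Ω × X => T p.1 p.2) (hf : Measurable fun p : Ω × X => f p.1 p.2)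
    (n : ℕ) : Measurable fun p : Ω × X => Snf ϑ T f n p.1 p.2 :=
  Finset.measurable_sum _ fun i _ =>
    hf.comp (((hϑ.iterate i).comp measurable_fst).prodMk (measurable_Tn hϑ hT i))

end Iterates

section Counting

/-- A compact metric space has a finite colouring with colour classes of diameter at most `ε`. -/
lemma exists_finite_coloring (X : Type) [MetricSpace X] [CompactSpace X] {ε : ℝ} (hε : 0 < ε) :
    ∃ N : ℕ, 0 < N ∧ ∃ c : X → Fin N, ∀ x y, c x = c y → dist x y ≤ ε := by
  obtain ⟨t, ht, hcov⟩ := Metric.totallyBounded_iff.1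
    (isCompact_univ (X := X)).totallyBounded (ε / 2) (half_pos hε)
  have hcov' : ∀ x, ∃ y ∈ ht.toFinset, dist x y < ε / 2 := fun x => by
    simpa using hcov (mem_univ x)
  choose p hp hd using hcov'
  refine ⟨ht.toFinset.card + 1, Nat.succ_pos _,
    fun x => (ht.toFinset.equivFin ⟨p x, hp x⟩).castSucc, fun x y hxy => ?_⟩
  have hpxy : p x = p y := by simpa using hxy
  have h1 := hd x
  rw [hpxy] at h1
  linarith [dist_triangle_right x y (p y), hd y]

/-- Splitting a separated set according to the colours of the orbits at times in `J` costs a factor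
`N ^ #J`, and within each class the points are separated at times outside `J`. -/
lemma sum_le_pow_card_mul {ϑ : Ω → Ω} {T : Ω → X → X} {n N : ℕ} {ε : ℝ} (hε : 0 ≤ ε) {ω : Ω}
    {c : X → Fin N} (hc : ∀ x y, c x = c y → dist x y ≤ ε) {F : Finset X}
    (hF : IsSep ϑ T n ε ω F) (J : Finset ℕ) (w : X → ℝ) (B : ℝ)
    (h : ∀ G ⊆ F, (∀ y ∈ G, ∀ z ∈ G, y ≠ z →
      ∃ t < n, t ∉ J ∧ ε < dist (Tn ϑ T t ω y) (Tn ϑ T t ω z)) → ∑ y ∈ G, w y ≤ B) :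
    ∑ y ∈ F, w y ≤ (N : ℝ) ^ J.card * B := by
  classical
  let L : X → (J → Fin N) := fun y t => c (Tn ϑ T t ω y)
  rw [← Finset.sum_fiberwise F L w]
  calc ∑ a : J → Fin N, ∑ y ∈ F with L y = a, w y ≤ ∑ _a : J → Fin N, B := by
        refine Finset.sum_le_sum fun a _ => h _ (Finset.filter_subset _ _) ?_
        intro y hy z hz hyz
        rw [Finset.mem_filter] at hy hz
        obtain ⟨t, ht, hd⟩ := (lt_dn_iff hε).1 (hF y hy.1 z hz.1 hyz)
        refine ⟨t, ht, fun htJ => hd.not_ge (hc _ _ ?_), hd⟩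
        exact congrFun (hy.2.trans hz.2.symm) ⟨t, htJ⟩
    _ = (N : ℝ) ^ J.card * B := by simp

end Counting

/-- The standing assumptions on a bundle RDS and a potential dominated by an integrable function of
the base point. -/
structure Dominated (P : Measure Ω) (ϑ : Ω → Ω) (T : Ω → X → X) (E : Set (Ω × X))
    (f : Ω → X → ℝ) (b : Ω → ℝ) : Prop where
  preserving : MeasurePreserving ϑ P P
  measurableSet : MeasurableSet E
  mapsTo : ∀ ω, MapsTo (T ω) (fiber E ω) (fiber E (ϑ ω))
  measurable_map : Measurable fun p : Ω × X => T p.1 p.2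
  nonempty : ∀ k : ℕ, ∀ x ∈ XE E, ∀ ω : Ω, (preFiber ϑ T E k x ω).Nonempty
  measurable_fun : Measurable fun p : Ω × X => f p.1 p.2
  integrable : Integrable b P
  abs_le : ∀ ω, ∀ x ∈ fiber E ω, |f ω x| ≤ b ω

lemma integrable_birkhoffSum {α : Type*} [MeasurableSpace α] {μ : Measure α} {φ : α → α}
    (hφ : MeasurePreserving φ μ μ) {b : α → ℝ} (hb : Integrable b μ) (n : ℕ) :
    Integrable (fun a => birkhoffSum φ b n a) μ :=
  integrable_finsetSum _ fun i _ => (hφ.iterate i).integrable_comp_of_integrable hb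

lemma integral_comp_iterate {α : Type*} [MeasurableSpace α] {μ : Measure α} {φ : α → α}
    (hφ : MeasurePreserving φ μ μ) {b : α → ℝ} (hb : AEStronglyMeasurable b μ) (n : ℕ) :
    ∫ a, b (φ^[n] a) ∂μ = ∫ a, b a ∂μ := by
  have h := hφ.iterate n
  rw [← integral_map (φ := φ^[n]) h.measurable.aemeasurable (by rwa [h.map_eq]), h.map_eq]

lemma integral_birkhoffSum {α : Type*} [MeasurableSpace α] {μ : Measure α} {φ : α → α}
    (hφ : MeasurePreserving φ μ μ) {b : α → ℝ} (hb : Integrable b μ) (n : ℕ) :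
    ∫ a, birkhoffSum φ b n a ∂μ = n * ∫ a, b a ∂μ := by
  simp only [birkhoffSum]
  rw [integral_finsetSum (f := fun i a => b (φ^[i] a)) _
    fun i _ => (hφ.iterate i).integrable_comp_of_integrable hb]
  simp [integral_comp_iterate hφ hb.1]

/-- The numerator of `PpreEps` at time `n`. -/
noncomputable def growth (P : Measure Ω) (ϑ : Ω → Ω) (T : Ω → X → X) (E : Set (Ω × X))
    (f : Ω → X → ℝ) (ε : ℝ) (n : ℕ) : ℝ :=
  sSup {r : ℝ | ∃ k ≥ n, ∃ x ∈ XE E, r = ∫ ω, Real.log (PpreN ϑ T E f n k ε x ω) ∂P}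

lemma growth_of_XE_eq_empty {P : Measure Ω} {ϑ : Ω → Ω} {T : Ω → X → X} {E : Set (Ω × X)}
    {f : Ω → X → ℝ} {ε : ℝ} (h : XE E = ∅) (n : ℕ) : growth P ϑ T E f ε n = 0 := by
  simp [growth, h]

namespace Dominated

variable {P : Measure Ω} {ϑ : Ω → Ω} {T : Ω → X → X} {E : Set (Ω × X)} {f : Ω → X → ℝ}
  {b : Ω → ℝ}

lemma abs_Snf_le (D : Dominated P ϑ T E f b) (n : ℕ) {ω : Ω} {y : X} (hy : y ∈ fiber E ω) :
    |Snf ϑ T f n ω y| ≤ birkhoffSum ϑ b n ω :=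
  (Finset.abs_sum_le_sum_abs _ _).trans
    (Finset.sum_le_sum fun i _ => D.abs_le _ _ (mapsTo_Tn D.mapsTo i ω hy))

lemma iterate (D : Dominated P ϑ T E f b) (m : ℕ) :
    Dominated P (ϑ^[m]) (fun ω => Tn ϑ T m ω) E (fun ω => Snf ϑ T f m ω)
      (fun ω => birkhoffSum ϑ b m ω) where
  preserving := D.preserving.iterate m
  measurableSet := D.measurableSet
  mapsTo := mapsTo_Tn D.mapsTo m
  measurable_map := measurable_Tn D.preserving.measurable D.measurable_map m
  nonempty k x hx ω := by
    rw [preFiber_iterate]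
    exact D.nonempty _ x hx ω
  measurable_fun := measurable_Snf D.preserving.measurable D.measurable_map D.measurable_fun m
  integrable := integrable_birkhoffSum D.preserving D.integrable m
  abs_le ω x hx := D.abs_Snf_le m hx

section Bounds

variable {N : ℕ} {ε : ℝ} {c : X → Fin N}

lemma sum_exp_le (D : Dominated P ϑ T E f b) (hε : 0 ≤ ε)
    (hc : ∀ x y, c x = c y → dist x y ≤ ε) {n k : ℕ} {x : X} {ω : Ω} {F : Finset X}
    (hF : ↑F ⊆ preFiber ϑ T E k x ω) (hs : IsSep ϑ T n ε ω F) :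
    ∑ y ∈ F, Real.exp (Snf ϑ T f n ω y) ≤ (N : ℝ) ^ n * Real.exp (birkhoffSum ϑ b n ω) := by
  have key := sum_le_pow_card_mul hε hc hs (Finset.range n)
    (fun y => Real.exp (Snf ϑ T f n ω y)) (Real.exp (birkhoffSum ϑ b n ω)) ?_
  · simpa using key
  intro G hG hGs
  have hsub : ∀ y ∈ G, ∀ z ∈ G, y = z := by
    intro y hy z hz
    by_contra hyz
    obtain ⟨t, ht, htJ, -⟩ := hGs y hy z hz hyz
    exact htJ (Finset.mem_range.2 ht)
  have hle : ∀ y ∈ G, Real.exp (Snf ϑ T f n ω y) ≤ Real.exp (birkhoffSum ϑ b n ω) := fun y hy =>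
    Real.exp_le_exp.2 ((le_abs_self _).trans (D.abs_Snf_le n (hF (hG hy)).1))
  refine (Finset.sum_le_card_nsmul _ _ _ hle).trans ?_
  rw [nsmul_eq_mul]
  have : (G.card : ℝ) ≤ 1 := by exact_mod_cast Finset.card_le_one.2 hsub
  nlinarith [Real.exp_pos (birkhoffSum ϑ b n ω)]

lemma bddAbove (D : Dominated P ϑ T E f b) (hε : 0 < ε) (n k : ℕ) (x : X) (ω : Ω) :
    BddAbove {r : ℝ | ∃ F : Finset X, ↑F ⊆ preFiber ϑ T E k x ω ∧ IsSep ϑ T n ε ω ↑F ∧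
      r = ∑ y ∈ F, Real.exp (Snf ϑ T f n ω y)} := by
  obtain ⟨N, -, c, hc⟩ := exists_finite_coloring X hε
  refine ⟨(N : ℝ) ^ n * Real.exp (birkhoffSum ϑ b n ω), ?_⟩
  rintro _ ⟨F, hF, hs, rfl⟩
  exact D.sum_exp_le hε.le hc hF hs

lemma sum_le_PpreN (D : Dominated P ϑ T E f b) (hε : 0 < ε) {n k : ℕ} {x : X} {ω : Ω}
    {F : Finset X} (hF : ↑F ⊆ preFiber ϑ T E k x ω) (hs : IsSep ϑ T n ε ω F) :
    ∑ y ∈ F, Real.exp (Snf ϑ T f n ω y) ≤ PpreN ϑ T E f n k ε x ω :=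
  le_csSup (D.bddAbove hε n k x ω) ⟨F, hF, hs, rfl⟩

lemma PpreN_le {B : ℝ} {n k : ℕ} {x : X} {ω : Ω}
    (h : ∀ F : Finset X, ↑F ⊆ preFiber ϑ T E k x ω → IsSep ϑ T n ε ω F →
      ∑ y ∈ F, Real.exp (Snf ϑ T f n ω y) ≤ B) : PpreN ϑ T E f n k ε x ω ≤ B := by
  refine csSup_le ⟨0, ∅, by simp, fun y hy => by simp at hy, by simp⟩ ?_
  rintro _ ⟨F, hF, hs, rfl⟩
  exact h F hF hs

lemma exp_neg_le_PpreN (D : Dominated P ϑ T E f b) (hε : 0 < ε) (n k : ℕ) {x : X}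
    (hx : x ∈ XE E) (ω : Ω) :
    Real.exp (-birkhoffSum ϑ b n ω) ≤ PpreN ϑ T E f n k ε x ω := by
  obtain ⟨y, hy⟩ := D.nonempty k x hx ω
  have h := D.sum_le_PpreN hε (n := n) (F := {y}) (by simpa using hy)
    (by simpa using isSep_singleton ϑ T n ε ω y)
  rw [Finset.sum_singleton] at h
  exact (Real.exp_le_exp.2 (neg_le_of_abs_le (D.abs_Snf_le n hy.1))).trans h

lemma PpreN_pos (D : Dominated P ϑ T E f b) (hε : 0 < ε) (n k : ℕ) {x : X}
    (hx : x ∈ XE E) (ω : Ω) : 0 < PpreN ϑ T E f n k ε x ω :=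
  (Real.exp_pos _).trans_le (D.exp_neg_le_PpreN hε n k hx ω)

lemma abs_log_PpreN_le (D : Dominated P ϑ T E f b) (hε : 0 < ε) (hN : 0 < N)
    (hc : ∀ x y, c x = c y → dist x y ≤ ε) (n k : ℕ) {x : X} (hx : x ∈ XE E) (ω : Ω) :
    |Real.log (PpreN ϑ T E f n k ε x ω)| ≤ n * Real.log N + birkhoffSum ϑ b n ω := by
  have hN' : (0 : ℝ) < N := by exact_mod_cast hN
  have hlogN : 0 ≤ Real.log N := Real.log_natCast_nonneg N
  have h1 := Real.log_le_log (Real.exp_pos _) (D.exp_neg_le_PpreN hε n k hx ω)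
  have h2 := Real.log_le_log (D.PpreN_pos hε n k hx ω)
    (PpreN_le fun F hF hs => D.sum_exp_le hε.le hc hF hs)
  rw [Real.log_exp] at h1
  rw [Real.log_mul (by positivity) (by positivity), Real.log_exp, Real.log_pow] at h2
  refine _root_.abs_le.2 ⟨?_, h2⟩
  have : 0 ≤ (n : ℝ) * Real.log N := by positivity
  linarith

end Bounds

section Measurability

lemma lt_PpreN_iff (D : Dominated P ϑ T E f b) {ε : ℝ} (hε : 0 < ε) {n k : ℕ} {x : X} {ω : Ω}
    {a : ℝ} : a < PpreN ϑ T E f n k ε x ω ↔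
      ∃ (j : ℕ) (y : Fin j → X), (∀ i, y i ∈ preFiber ϑ T E k x ω) ∧
        (∀ i i', i ≠ i' → ∃ t < n, ε < dist (Tn ϑ T t ω (y i)) (Tn ϑ T t ω (y i'))) ∧
        a < ∑ i, Real.exp (Snf ϑ T f n ω (y i)) := by
  classical
  constructor
  · intro h
    obtain ⟨F, hF, hs, ha⟩ : ∃ F : Finset X, ↑F ⊆ preFiber ϑ T E k x ω ∧ IsSep ϑ T n ε ω F ∧
        a < ∑ y ∈ F, Real.exp (Snf ϑ T f n ω y) := by
      by_contra! hcon
      exact h.not_ge (PpreN_le hcon)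
    refine ⟨F.card, fun i => F.equivFin.symm i, fun i => hF (F.equivFin.symm i).2,
      fun i i' hi => (lt_dn_iff hε.le).1 (hs _ (F.equivFin.symm i).2 _ (F.equivFin.symm i').2 ?_),
      ?_⟩
    · simpa [Subtype.ext_iff] using hi
    · rwa [F.equivFin.symm.sum_comp (fun y : F => Real.exp (Snf ϑ T f n ω y)),
        Finset.sum_coe_sort F fun y => Real.exp (Snf ϑ T f n ω y)]
  · rintro ⟨j, y, hy, hs, ha⟩
    have hinj : Function.Injective y := by
      intro i i' hii
      by_contra hne
      obtain ⟨t, -, ht⟩ := hs i i' hne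
      rw [hii, dist_self] at ht
      exact hε.not_gt ht
    have h := D.sum_le_PpreN hε (n := n) (F := Finset.univ.image y) (k := k) (x := x) (ω := ω)
      (by simpa [subset_def] using hy) (by
        intro u hu v hv huv
        simp only [Finset.coe_image, Finset.coe_univ, image_univ, mem_range] at hu hv
        obtain ⟨i, rfl⟩ := hu
        obtain ⟨i', rfl⟩ := hv
        exact (lt_dn_iff hε.le).2 (hs i i' fun h => huv (congrArg y h)))
    rw [Finset.sum_image fun _ _ _ _ h => hinj h] at h
    exact ha.trans_le h

lemma aemeasurable_PpreN [MeasurableSpace.CountablyGenerated Ω] [IsFiniteMeasure P]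
    (D : Dominated P ϑ T E f b) {ε : ℝ} (hε : 0 < ε) (n k : ℕ) (x : X) :
    AEMeasurable (fun ω => PpreN ϑ T E f n k ε x ω) P := by
  have hϑ := D.preserving.measurable
  suffices h : NullMeasurable (fun ω => PpreN ϑ T E f n k ε x ω) P from h.aemeasurable
  refine measurable_of_Ioi (δ := NullMeasurableSpace Ω P) fun a => ?_
  let S : (j : ℕ) → Set (Ω × (Fin j → X)) := fun j =>
    {p | (∀ i, p.2 i ∈ preFiber ϑ T E k x p.1) ∧
      (∀ i i', i ≠ i' → ∃ t < n, ε < dist (Tn ϑ T t p.1 (p.2 i)) (Tn ϑ T t p.1 (p.2 i'))) ∧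
      a < ∑ i, Real.exp (Snf ϑ T f n p.1 (p.2 i))}
  have hpair : ∀ (j : ℕ) (i : Fin j), Measurable fun p : Ω × (Fin j → X) => (p.1, p.2 i) :=
    fun j i => measurable_fst.prodMk ((measurable_pi_apply i).comp measurable_snd)
  have hTn : ∀ (j : ℕ) (i : Fin j) (t : ℕ),
      Measurable fun p : Ω × (Fin j → X) => Tn ϑ T t p.1 (p.2 i) := fun j i t =>
    (measurable_Tn hϑ D.measurable_map t).comp (hpair j i)
  have hS : ∀ j, MeasurableSet (S j) := by
    intro j
    have hSj : S j = (⋂ i, {p | p.2 i ∈ preFiber ϑ T E k x p.1}) ∩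
        ((⋂ i, ⋂ i', ⋂ (_ : i ≠ i'), ⋃ t, ⋃ (_ : t < n),
          {p | ε < dist (Tn ϑ T t p.1 (p.2 i)) (Tn ϑ T t p.1 (p.2 i'))}) ∩
        {p | a < ∑ i, Real.exp (Snf ϑ T f n p.1 (p.2 i))}) := by
      ext p
      simp only [S, mem_inter_iff, mem_iInter, mem_iUnion, mem_ofPred_eq, exists_prop]
    rw [hSj]
    refine .inter (.iInter fun i => ?_) (.inter
      (.iInter fun i => .iInter fun i' => .iInter fun _ => .iUnion fun t => .iUnion fun _ =>
        measurableSet_lt measurable_const ((hTn j i t).dist (hTn j i' t)))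
      (measurableSet_lt measurable_const (Finset.measurable_sum _ fun i _ => ?_)))
    · exact (hpair j i D.measurableSet).inter (hTn j i k (measurableSet_singleton x))
    · exact ((measurable_Snf hϑ D.measurable_map D.measurable_fun n).comp (hpair j i)).exp
  have heq : (fun ω => PpreN ϑ T E f n k ε x ω) ⁻¹' Ioi a = ⋃ j, Prod.fst '' S j := by
    ext ω
    simp only [mem_preimage, mem_Ioi, D.lt_PpreN_iff hε, mem_iUnion, mem_image, Prod.exists,
      exists_and_right, exists_eq_right]
    rfl
  have hnull : NullMeasurableSet ((fun ω => PpreN ϑ T E f n k ε x ω) ⁻¹' Ioi a) P := by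
    rw [heq]
    exact NullMeasurableSet.iUnion fun j => nullMeasurableSet_image_fst P (hS j)
  exact hnull

lemma integrable_log_PpreN [MeasurableSpace.CountablyGenerated Ω] [IsFiniteMeasure P]
    (D : Dominated P ϑ T E f b) {ε : ℝ} (hε : 0 < ε) (n k : ℕ) {x : X} (hx : x ∈ XE E) :
    Integrable (fun ω => Real.log (PpreN ϑ T E f n k ε x ω)) P := by
  obtain ⟨N, hN, c, hc⟩ := exists_finite_coloring X hε
  exact ((integrable_const _).add (integrable_birkhoffSum D.preserving D.integrable n)).mono'
    (Real.measurable_log.comp_aemeasurable (D.aemeasurable_PpreN hε n k x)).aestronglyMeasurable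
    (.of_forall fun ω => D.abs_log_PpreN_le hε hN hc n k hx ω)

end Measurability

section Comparison

lemma sum_exp_le_mul_PpreN_iterate (D : Dominated P ϑ T E f b) {ε δ : ℝ} (hε : 0 ≤ ε) (hδ : 0 < δ)
    {m r i s j : ℕ} {x : X} {ω : Ω} {G : Finset X}
    (hG : ↑G ⊆ preFiber ϑ T E (r + m * j) x ω)
    (hsep : ∀ y ∈ G, ∀ z ∈ G, y ≠ z → ∃ l < i, ∃ u < m,
      ε < dist (Tn ϑ T (r + (m * l + u)) ω y) (Tn ϑ T (r + (m * l + u)) ω z) ∧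
      δ < dist (Tn ϑ T (r + m * l) ω y) (Tn ϑ T (r + m * l) ω z)) :
    ∑ y ∈ G, Real.exp (Snf ϑ T f (r + (m * i + s)) ω y) ≤
      Real.exp (birkhoffSum ϑ b r ω + birkhoffSum ϑ b s (ϑ^[m * i] (ϑ^[r] ω))) *
        PpreN (ϑ^[m]) (fun ω => Tn ϑ T m ω) E (fun ω => Snf ϑ T f m ω) i j δ x (ϑ^[r] ω) := by
  classical
  have hinj : Set.InjOn (Tn ϑ T r ω) G := by
    intro y hy z hz hyz
    by_contra hne
    obtain ⟨l, -, u, -, hd, -⟩ := hsep y hy z hz hne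
    rw [Tn_add, Tn_add ϑ T r _ ω z, hyz, dist_self] at hd
    exact hd.not_ge hε
  have h := (D.iterate m).sum_le_PpreN hδ (n := i) (k := j) (x := x) (ω := ϑ^[r] ω)
    (F := G.image (Tn ϑ T r ω)) (by
      rw [preFiber_iterate, Finset.coe_image]
      rintro _ ⟨y, hy, rfl⟩
      exact ⟨mapsTo_Tn D.mapsTo r ω (hG hy).1, by rw [← Tn_add]; exact (hG hy).2⟩) (by
      rw [Finset.coe_image]
      rintro _ ⟨y, hy, rfl⟩ _ ⟨z, hz, rfl⟩ hne
      obtain ⟨l, hl, -, -, -, hd⟩ := hsep y hy z hz fun h => hne (congrArg _ h)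
      refine (lt_dn_iff hδ.le).2 ⟨l, hl, ?_⟩
      rwa [Tn_iterate, Tn_iterate, ← Tn_add, ← Tn_add])
  rw [Finset.sum_image hinj] at h
  refine le_trans ?_ (mul_le_mul_of_nonneg_left h (Real.exp_pos _).le)
  rw [Finset.mul_sum]
  refine Finset.sum_le_sum fun y hy => ?_
  have hy' := (hG hy).1
  have hr := mapsTo_Tn D.mapsTo r ω hy'
  rw [← Real.exp_add, Real.exp_le_exp, Snf_add, Snf_add, Snf_iterate]
  have h1 := (le_abs_self _).trans (D.abs_Snf_le r hy')
  have h2 := (le_abs_self _).trans (D.abs_Snf_le s (mapsTo_Tn D.mapsTo (m * i) _ hr))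
  linarith

/-- Compared with the iterated system, the pre-image sums of the original system at scale `ε` gain
at most a factor of the number of colours for each time before `r`, after `r + m * i`, or in a block
of length `m` starting in the set `B` of base points with a bad modulus of continuity. -/
lemma PpreN_le_mul_PpreN_iterate (D : Dominated P ϑ T E f b) {ε δ : ℝ} (hε : 0 ≤ ε) (hδ : 0 < δ)
    {N : ℕ} (hN : 0 < N) {c : X → Fin N} (hc : ∀ x y, c x = c y → dist x y ≤ ε)
    {m : ℕ} (hm : 0 < m) {B : Set Ω}
    (hB : ∀ ω ∉ B, ∀ y ∈ fiber E ω, ∀ z ∈ fiber E ω, dist y z ≤ δ →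
      ∀ u < m, dist (Tn ϑ T u ω y) (Tn ϑ T u ω z) ≤ ε)
    (r i s j : ℕ) {x : X} (hx : x ∈ XE E) (ω : Ω) {q : ℕ}
    (hq : (q : ℝ) = birkhoffSum (ϑ^[m]) (B.indicator 1) i (ϑ^[r] ω)) :
    PpreN ϑ T E f (r + (m * i + s)) (r + m * j) ε x ω ≤ (N : ℝ) ^ (r + s + q * m) *
      (Real.exp (birkhoffSum ϑ b r ω + birkhoffSum ϑ b s (ϑ^[m * i] (ϑ^[r] ω))) *
        PpreN (ϑ^[m]) (fun ω => Tn ϑ T m ω) E (fun ω => Snf ϑ T f m ω) i j δ x (ϑ^[r] ω)) := by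
  classical
  let bad : Finset ℕ := {l ∈ Finset.range i | (ϑ^[m])^[l] (ϑ^[r] ω) ∈ B}
  have hbad : bad.card = q := by
    have : (bad.card : ℝ) = q := by
      rw [hq, birkhoffSum, Finset.card_filter]
      push_cast
      exact Finset.sum_congr rfl fun l _ => by simp [indicator_apply]
    exact_mod_cast this
  let J : Finset ℕ := Finset.range r ∪ Finset.Ico (r + m * i) (r + m * i + s) ∪
    bad.biUnion fun l => Finset.Ico (r + m * l) (r + m * l + m)
  have hJ : J.card ≤ r + s + q * m := by
    refine (Finset.card_union_le _ _).trans (add_le_add ?_ ?_)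
    · exact (Finset.card_union_le _ _).trans (by simp)
    · rw [← hbad]
      exact Finset.card_biUnion_le_card_mul _ _ _ fun l _ => by simp
  have hpos := (D.iterate m).PpreN_pos hδ i j hx (ϑ^[r] ω)
  refine PpreN_le fun F hF hs => ?_
  refine (sum_le_pow_card_mul hε hc hs J _ _ fun G hGF hGs =>
    D.sum_exp_le_mul_PpreN_iterate hε hδ (i := i) (s := s) (j := j) (x := x)
      (Subset.trans (by exact_mod_cast hGF) hF) ?_).trans
    (mul_le_mul_of_nonneg_right (pow_le_pow_right₀ (by exact_mod_cast hN) hJ) (by positivity))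
  intro y hy z hz hyz
  obtain ⟨t, ht, htJ, hd⟩ := hGs y hy z hz hyz
  simp only [J, Finset.mem_union, Finset.mem_range, Finset.mem_Ico, Finset.mem_biUnion, not_or,
    not_and, not_lt, not_exists] at htJ
  obtain ⟨⟨hrt, hti⟩, hblock⟩ := htJ
  have hti' : t - r < m * i := by
    by_contra! h
    have := hti (by omega)
    omega
  have hdm : t = r + (m * ((t - r) / m) + (t - r) % m) := by
    rw [Nat.div_add_mod]; omega
  have hu := Nat.mod_lt (t - r) hm
  have hl : (t - r) / m < i := Nat.div_lt_of_lt_mul hti'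
  generalize (t - r) / m = l at hdm hl
  generalize (t - r) % m = u at hdm hu
  subst hdm
  refine ⟨l, hl, u, hu, hd, ?_⟩
  have hlB : ϑ^[r + m * l] ω ∉ B := by
    intro hmem
    have := hblock l (by
      rw [Nat.add_comm, Function.iterate_add_apply, Function.iterate_mul] at hmem
      simp [bad, hl, hmem]) (by omega)
    omega
  by_contra! hle
  have hfib : ∀ y ∈ G, Tn ϑ T (r + m * l) ω y ∈ fiber E (ϑ^[r + m * l] ω) := fun y hy =>
    mapsTo_Tn D.mapsTo _ _ (hF (hGF hy)).1
  have := hB _ hlB _ (hfib y hy) _ (hfib z hz) hle u hu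
  rw [← Tn_add, ← Tn_add, Nat.add_assoc] at this
  exact hd.not_ge this

/-- The integrated form of `PpreN_le_mul_PpreN_iterate`. -/
lemma integral_log_PpreN_le [MeasurableSpace.CountablyGenerated Ω] [IsProbabilityMeasure P]
    (D : Dominated P ϑ T E f b) {ε δ : ℝ} (hε : 0 < ε) (hδ : 0 < δ)
    {N : ℕ} (hN : 0 < N) {c : X → Fin N} (hc : ∀ x y, c x = c y → dist x y ≤ ε)
    {m : ℕ} (hm : 0 < m) {B : Set Ω} (hBm : MeasurableSet B)
    (hB : ∀ ω ∉ B, ∀ y ∈ fiber E ω, ∀ z ∈ fiber E ω, dist y z ≤ δ →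
      ∀ u < m, dist (Tn ϑ T u ω y) (Tn ϑ T u ω z) ≤ ε)
    (r i s j : ℕ) {x : X} (hx : x ∈ XE E) :
    ∫ ω, Real.log (PpreN ϑ T E f (r + (m * i + s)) (r + m * j) ε x ω) ∂P ≤
      (r + s + i * P.real B * m) * Real.log N + (r + s) * ∫ ω, b ω ∂P +
        ∫ ω, Real.log (PpreN (ϑ^[m]) (fun ω => Tn ϑ T m ω) E
          (fun ω => Snf ϑ T f m ω) i j δ x ω) ∂P := by
  have hϑ := D.preserving
  have hN' : (0 : ℝ) < N := by exact_mod_cast hN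
  let ψ : Ω → ℝ := fun ω => Real.log (PpreN (ϑ^[m]) (fun ω => Tn ϑ T m ω) E
    (fun ω => Snf ϑ T f m ω) i j δ x ω)
  let β : Ω → ℝ := birkhoffSum (ϑ^[m]) (B.indicator 1) i
  have hψ : Integrable ψ P := (D.iterate m).integrable_log_PpreN hδ i j hx
  have hind : Integrable (B.indicator (1 : Ω → ℝ)) P :=
    (integrable_const (1 : ℝ)).indicator hBm
  have hβ : Integrable β P := integrable_birkhoffSum (hϑ.iterate m) hind i
  have hbr := integrable_birkhoffSum hϑ D.integrable r
  have hbs := integrable_birkhoffSum hϑ D.integrable s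
  have hβ' := (hϑ.iterate r).integrable_comp_of_integrable hβ
  have hψ' := (hϑ.iterate r).integrable_comp_of_integrable hψ
  have hbs' := (hϑ.iterate r).integrable_comp_of_integrable
    ((hϑ.iterate (m * i)).integrable_comp_of_integrable hbs)
  have hpt : ∀ ω, Real.log (PpreN ϑ T E f (r + (m * i + s)) (r + m * j) ε x ω) ≤
      ((r + s) * Real.log N + m * Real.log N * β (ϑ^[r] ω)) +
        (birkhoffSum ϑ b r ω + birkhoffSum ϑ b s (ϑ^[m * i] (ϑ^[r] ω))) + ψ (ϑ^[r] ω) := by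
    intro ω
    obtain ⟨q, hq⟩ : ∃ q : ℕ, (q : ℝ) = β (ϑ^[r] ω) := by
      classical
      refine ⟨({l ∈ Finset.range i | (ϑ^[m])^[l] (ϑ^[r] ω) ∈ B} : Finset ℕ).card, ?_⟩
      rw [Finset.card_filter]
      push_cast
      exact Finset.sum_congr rfl fun l _ => by simp [indicator_apply]
    have h := Real.log_le_log (D.PpreN_pos hε _ _ hx ω)
      (D.PpreN_le_mul_PpreN_iterate hε.le hδ hN hc hm hB r i s j hx ω hq)
    have hpos := (D.iterate m).PpreN_pos hδ i j hx (ϑ^[r] ω)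
    rw [Real.log_mul (by positivity) (by positivity), Real.log_mul (by positivity) hpos.ne',
      Real.log_exp, Real.log_pow] at h
    rw [← hq]
    push_cast at h
    refine h.trans (le_of_eq ?_)
    ring
  have h1 := ((integrable_const ((r + s : ℝ) * Real.log N)).add (hβ'.const_mul (m * Real.log N)))
  have h2 := hbr.add hbs'
  refine (integral_mono (D.integrable_log_PpreN hε _ _ hx) ((h1.add h2).add hψ') hpt).trans
    (le_of_eq ?_)
  rw [integral_add' (h1.add h2) hψ', integral_add' h1 h2,
    integral_add' (integrable_const _) (hβ'.const_mul _), integral_add' hbr hbs',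
    integral_birkhoffSum hϑ D.integrable]
  have e1 : ∫ ω, β (ϑ^[r] ω) ∂P = i * P.real B := by
    rw [integral_comp_iterate hϑ hβ.1, integral_birkhoffSum (hϑ.iterate m) hind,
      integral_indicator_one hBm]
  have e2 : ∫ ω, birkhoffSum ϑ b s (ϑ^[m * i] (ϑ^[r] ω)) ∂P = s * ∫ ω, b ω ∂P := by
    rw [integral_comp_iterate hϑ (b := fun ω => birkhoffSum ϑ b s (ϑ^[m * i] ω))
      ((hϑ.iterate (m * i)).integrable_comp_of_integrable hbs).1,
      integral_comp_iterate hϑ hbs.1, integral_birkhoffSum hϑ D.integrable]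
  have e3 : ∫ ω, ψ (ϑ^[r] ω) ∂P = ∫ ω, ψ ω ∂P := integral_comp_iterate hϑ hψ.1 r
  simp only [Function.comp_apply]
  rw [integral_const, probReal_univ, one_smul, integral_const_mul, e1, e2, e3]
  ring

end Comparison

section Growth

lemma exists_abs_integral_le [MeasurableSpace.CountablyGenerated Ω] [IsProbabilityMeasure P]
    (D : Dominated P ϑ T E f b) {ε : ℝ} (hε : 0 < ε) :
    ∃ C : ℝ, 0 ≤ C ∧ ∀ n k : ℕ, ∀ x ∈ XE E,
      |∫ ω, Real.log (PpreN ϑ T E f n k ε x ω) ∂P| ≤ n * C := by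
  obtain ⟨N, hN, c, hc⟩ := exists_finite_coloring X hε
  have hlog : 0 ≤ Real.log N := Real.log_natCast_nonneg N
  refine ⟨Real.log N + |∫ ω, b ω ∂P|, by positivity, fun n k x hx => ?_⟩
  have hb := integrable_birkhoffSum D.preserving D.integrable n
  calc |∫ ω, Real.log (PpreN ϑ T E f n k ε x ω) ∂P|
      ≤ ∫ ω, |Real.log (PpreN ϑ T E f n k ε x ω)| ∂P := abs_integral_le_integral_abs
    _ ≤ ∫ ω, (n * Real.log N + birkhoffSum ϑ b n ω) ∂P :=
        integral_mono (D.integrable_log_PpreN hε n k hx).abs ((integrable_const _).add hb)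
          fun ω => D.abs_log_PpreN_le hε hN hc n k hx ω
    _ = n * (Real.log N + ∫ ω, b ω ∂P) := by
        rw [integral_add (integrable_const _) hb, integral_const, probReal_univ, one_smul,
          integral_birkhoffSum D.preserving D.integrable]
        ring
    _ ≤ n * (Real.log N + |∫ ω, b ω ∂P|) := by
        gcongr
        exact le_abs_self _

lemma integral_le_growth [MeasurableSpace.CountablyGenerated Ω] [IsProbabilityMeasure P]
    (D : Dominated P ϑ T E f b) {ε : ℝ} (hε : 0 < ε) {n k : ℕ} (hk : n ≤ k) {x : X}
    (hx : x ∈ XE E) :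
    ∫ ω, Real.log (PpreN ϑ T E f n k ε x ω) ∂P ≤ growth P ϑ T E f ε n := by
  obtain ⟨C, -, hC⟩ := D.exists_abs_integral_le hε
  refine le_csSup ⟨n * C, ?_⟩ ⟨k, hk, x, hx, rfl⟩
  rintro _ ⟨k, -, x, hx, rfl⟩
  exact (le_abs_self _).trans (hC n k x hx)

lemma exists_abs_inv_mul_growth_le [MeasurableSpace.CountablyGenerated Ω] [IsProbabilityMeasure P]
    (D : Dominated P ϑ T E f b) {ε : ℝ} (hε : 0 < ε) :
    ∃ C : ℝ, ∀ n : ℕ, |1 / (n : ℝ) * growth P ϑ T E f ε n| ≤ C := by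
  obtain ⟨C, hC0, hC⟩ := D.exists_abs_integral_le hε
  refine ⟨C, fun n => ?_⟩
  have key : |growth P ϑ T E f ε n| ≤ n * C := by
    refine _root_.abs_le.2 ⟨?_, Real.sSup_le ?_ (by positivity)⟩
    · rcases (XE E).eq_empty_or_nonempty with h | ⟨x, hx⟩
      · rw [growth_of_XE_eq_empty h]
        have : 0 ≤ n * C := by positivity
        linarith
      · exact (neg_le_of_abs_le (hC n n x hx)).trans (D.integral_le_growth hε le_rfl hx)
    · rintro _ ⟨k, -, x, hx, rfl⟩
      exact (le_abs_self _).trans (hC n k x hx)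
  rcases Nat.eq_zero_or_pos n with rfl | hn
  · simpa using hC0
  have hn' : (0 : ℝ) < n := by exact_mod_cast hn
  rw [abs_mul, abs_of_pos (by positivity : (0 : ℝ) < 1 / n), one_div, inv_mul_le_iff₀ hn']
  exact key

lemma PpreEps_le_of_eventually [MeasurableSpace.CountablyGenerated Ω] [IsProbabilityMeasure P]
    (D : Dominated P ϑ T E f b) {ε : ℝ} (hε : 0 < ε) {M : ℝ}
    (h : ∀ᶠ n : ℕ in atTop, 1 / (n : ℝ) * growth P ϑ T E f ε n ≤ M) :
    PpreEps P ϑ T E f ε ≤ M := by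
  obtain ⟨C, hC⟩ := D.exists_abs_inv_mul_growth_le hε
  exact limsup_le_of_le (IsBoundedUnder.isCoboundedUnder_le
    ⟨-C, eventually_map.2 (.of_forall fun n => neg_le_of_abs_le (hC n))⟩) h

lemma eventually_lt_of_PpreEps_lt [MeasurableSpace.CountablyGenerated Ω] [IsProbabilityMeasure P]
    (D : Dominated P ϑ T E f b) {ε : ℝ} (hε : 0 < ε) {M : ℝ} (h : PpreEps P ϑ T E f ε < M) :
    ∀ᶠ n : ℕ in atTop, 1 / (n : ℝ) * growth P ϑ T E f ε n < M := by
  obtain ⟨C, hC⟩ := D.exists_abs_inv_mul_growth_le hε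
  exact eventually_lt_of_limsup_lt h
    ⟨C, eventually_map.2 (.of_forall fun n => (le_abs_self _).trans (hC n))⟩

end Growth

lemma growth_iterate_le [MeasurableSpace.CountablyGenerated Ω] [IsProbabilityMeasure P]
    (D : Dominated P ϑ T E f b) {ε : ℝ} (hε : 0 < ε) {m : ℕ} (hm : 0 < m) (n : ℕ) :
    growth P (ϑ^[m]) (fun ω => Tn ϑ T m ω) E (fun ω => Snf ϑ T f m ω) ε n ≤
      growth P ϑ T E f ε (m * n) := by
  rcases (XE E).eq_empty_or_nonempty with h | ⟨x, hx⟩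
  · rw [growth_of_XE_eq_empty h, growth_of_XE_eq_empty h]
  refine csSup_le ⟨_, n, le_rfl, x, hx, rfl⟩ ?_
  rintro _ ⟨k, hk, x, hx, rfl⟩
  refine le_trans ?_ (D.integral_le_growth hε (Nat.mul_le_mul_left m hk) hx)
  refine integral_mono ((D.iterate m).integrable_log_PpreN hε n k hx)
    (D.integrable_log_PpreN hε _ _ hx) fun ω =>
      Real.log_le_log ((D.iterate m).PpreN_pos hε n k hx ω) (PpreN_le fun F hF hs => ?_)
  rw [preFiber_iterate] at hF
  simp only [Snf_iterate]
  exact D.sum_le_PpreN hε hF (hs.of_iterate hm hε.le)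

lemma PpreEps_iterate_le [MeasurableSpace.CountablyGenerated Ω] [IsProbabilityMeasure P]
    (D : Dominated P ϑ T E f b) {ε : ℝ} (hε : 0 < ε) {m : ℕ} (hm : 0 < m) :
    PpreEps P (ϑ^[m]) (fun ω => Tn ϑ T m ω) E (fun ω => Snf ϑ T f m ω) ε ≤
      m * PpreEps P ϑ T E f ε := by
  have hm' : (0 : ℝ) < m := by exact_mod_cast hm
  refine le_of_forall_gt_imp_ge_of_dense fun M hM => ?_
  have hM' : PpreEps P ϑ T E f ε < M / m := by rwa [lt_div_iff₀' hm']
  refine (D.iterate m).PpreEps_le_of_eventually hε ?_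
  have hev := (tendsto_id.const_mul_atTop' hm).eventually (D.eventually_lt_of_PpreEps_lt hε hM')
  filter_upwards [hev, eventually_gt_atTop 0] with n hn hn0
  have hn' : (0 : ℝ) < n := by exact_mod_cast hn0
  have hgr := D.growth_iterate_le hε hm n
  simp only [id, Nat.cast_mul] at hn
  rw [one_div, inv_mul_lt_iff₀ (by positivity)] at hn
  rw [one_div, inv_mul_le_iff₀ hn']
  calc _ ≤ _ := hgr
    _ ≤ _ := hn.le
    _ = n * M := by field_simp

/-- Outside a set of small measure, the first `m` iterates have a common modulus of continuity. -/
lemma exists_measurableSet_modulus [MeasurableSpace.CountablyGenerated Ω] [IsProbabilityMeasure P]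
    (D : Dominated P ϑ T E f b) (hE : ∀ ω, IsCompact (fiber E ω))
    (hT : ∀ᵐ ω ∂P, ContinuousOn (T ω) (fiber E ω)) {ε η : ℝ} (hε : 0 < ε) (hη : 0 < η) (m : ℕ) :
    ∃ δ > 0, ∃ B, MeasurableSet B ∧ P.real B ≤ η ∧
      ∀ ω ∉ B, ∀ y ∈ fiber E ω, ∀ z ∈ fiber E ω, dist y z ≤ δ →
        ∀ u < m, dist (Tn ϑ T u ω y) (Tn ϑ T u ω z) ≤ ε := by
  have hϑ := D.preserving.measurable
  let R : ℕ → Set (Ω × X × X) := fun q =>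
    {p | (p.1, p.2.1) ∈ E} ∩ {p | (p.1, p.2.2) ∈ E} ∩ {p | dist p.2.1 p.2.2 ≤ 1 / ((q : ℝ) + 1)} ∩
      ⋃ u, ⋃ (_ : u < m), {p | ε < dist (Tn ϑ T u p.1 p.2.1) (Tn ϑ T u p.1 p.2.2)}
  have h1 : Measurable fun p : Ω × X × X => (p.1, p.2.1) := by fun_prop
  have h2 : Measurable fun p : Ω × X × X => (p.1, p.2.2) := by fun_prop
  have hR : ∀ q, MeasurableSet (R q) := fun q =>
    (((h1 D.measurableSet).inter (h2 D.measurableSet)).inter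
      (measurableSet_le (measurable_fst.comp measurable_snd |>.dist
        (measurable_snd.comp measurable_snd)) measurable_const)).inter
    (.iUnion fun u => .iUnion fun _ => measurableSet_lt measurable_const
      (((measurable_Tn hϑ D.measurable_map u).comp h1).dist
        ((measurable_Tn hϑ D.measurable_map u).comp h2)))
  have hanti : Antitone fun q => Prod.fst '' R q := by
    intro a c hac
    have h : 1 / ((c : ℝ) + 1) ≤ 1 / ((a : ℝ) + 1) := by gcongr
    exact image_mono fun p hp => ⟨⟨hp.1.1,
      (show dist p.2.1 p.2.2 ≤ 1 / ((c : ℝ) + 1) from hp.1.2).trans h⟩, hp.2⟩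
  have hlim := tendsto_measure_iInter_atTop (μ := P)
    (fun q => nullMeasurableSet_image_fst P (hR q)) hanti ⟨0, measure_ne_top _ _⟩
  have hzero : P (⋂ q, Prod.fst '' R q) = 0 := by
    have hc : ∀ᵐ ω ∂P, ∀ i, ContinuousOn (T (ϑ^[i] ω)) (fiber E (ϑ^[i] ω)) :=
      ae_all_iff.2 fun i => (D.preserving.iterate i).quasiMeasurePreserving.ae hT
    refine measure_mono_null ?_ (ae_iff.1 hc)
    intro ω hω hcω
    have hev : ∀ u, ∀ᶠ q : ℕ in atTop, ∀ y ∈ fiber E ω, ∀ z ∈ fiber E ω,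
        dist y z ≤ 1 / ((q : ℝ) + 1) → dist (Tn ϑ T u ω y) (Tn ϑ T u ω z) ≤ ε := by
      intro u
      obtain ⟨δ, hδ, hu⟩ := Metric.uniformContinuousOn_iff_le.1
        ((hE ω).uniformContinuousOn_of_continuous (continuousOn_Tn D.mapsTo hcω u)) ε hε
      filter_upwards [tendsto_one_div_add_atTop_nhds_zero_nat.eventually_le_const hδ]
        with q hq y hy z hz hd
      exact hu y hy z hz (hd.trans hq)
    obtain ⟨q, hq⟩ := ((Finset.range m).eventually_all.2 fun u _ => hev u).exists
    obtain ⟨⟨_, y, z⟩, ⟨⟨⟨hy, hz⟩, hd⟩, hu⟩, rfl⟩ := mem_iInter.1 hω q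
    simp only [mem_iUnion] at hu
    obtain ⟨u, hum, hu⟩ := hu
    exact (lt_irrefl ε) (lt_of_lt_of_le hu (hq u (Finset.mem_range.2 hum) y hy z hz hd))
  rw [hzero] at hlim
  obtain ⟨q, hq⟩ := (hlim.eventually_lt_const (ENNReal.ofReal_pos.2 hη)).exists
  refine ⟨1 / ((q : ℝ) + 1), by positivity, toMeasurable P (Prod.fst '' R q),
    measurableSet_toMeasurable _ _, ?_, fun ω hω y hy z hz hd u hu => ?_⟩
  · rw [Measure.real, measure_toMeasurable]
    exact ENNReal.toReal_le_of_le_ofReal hη.le hq.le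
  · by_contra! hlt
    refine hω (subset_toMeasurable _ _ ⟨(ω, y, z), ⟨⟨⟨hy, hz⟩, hd⟩, ?_⟩, rfl⟩)
    exact mem_iUnion.2 ⟨u, mem_iUnion.2 ⟨hu, hlt⟩⟩

/-- A bound for the pressure of the iterated system at all scales gives one for the original
system. -/
lemma PpreEps_le_of_forall_PpreEps_iterate_le [MeasurableSpace.CountablyGenerated Ω]
    [IsProbabilityMeasure P] (D : Dominated P ϑ T E f b) (hE : ∀ ω, IsCompact (fiber E ω))
    (hT : ∀ᵐ ω ∂P, ContinuousOn (T ω) (fiber E ω)) {m : ℕ} (hm : 0 < m) {M : ℝ} (hM : 0 ≤ M)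
    (h : ∀ δ > 0,
      PpreEps P (ϑ^[m]) (fun ω => Tn ϑ T m ω) E (fun ω => Snf ϑ T f m ω) δ ≤ M)
    {ε : ℝ} (hε : 0 < ε) : PpreEps P ϑ T E f ε ≤ M + 3 := by
  obtain ⟨N, hN, c, hc⟩ := exists_finite_coloring X hε
  have hlog : 0 ≤ Real.log N := Real.log_natCast_nonneg N
  obtain ⟨δ, hδ, B, hBm, hBP, hB⟩ := D.exists_measurableSet_modulus hE hT hε
    (η := 1 / (Real.log N + 1)) (by positivity) m
  have hpl : P.real B * Real.log N ≤ 1 := by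
    calc P.real B * Real.log N ≤ 1 / (Real.log N + 1) * (Real.log N + 1) := by gcongr; linarith
      _ = 1 := by field_simp
  obtain ⟨i₀, hi₀⟩ := eventually_atTop.1
    ((D.iterate m).eventually_lt_of_PpreEps_lt hδ (lt_of_le_of_lt (h δ hδ) (lt_add_one M)))
  obtain ⟨K, hK⟩ := exists_nat_ge (2 * m * (Real.log N + |∫ ω, b ω ∂P|))
  refine D.PpreEps_le_of_eventually hε ?_
  filter_upwards [eventually_ge_atTop K, eventually_ge_atTop (m * (i₀ + 2))] with n hnK hn
  have hn2 : i₀ + 2 ≤ n / m := (Nat.le_div_iff_mul_le hm).2 (by rwa [Nat.mul_comm])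
  have hn0 : 0 < n := lt_of_lt_of_le (by positivity) hn
  have hn' : (0 : ℝ) < n := by exact_mod_cast hn0
  rw [one_div, inv_mul_le_iff₀ hn']
  refine Real.sSup_le ?_ (by positivity)
  rintro _ ⟨k, hk, x, hx, rfl⟩
  obtain ⟨i, hi⟩ : ∃ i, n / m = i + 1 := ⟨n / m - 1, by omega⟩
  have hr := Nat.mod_lt k hm
  have hnm := Nat.div_add_mod n m
  have hnr := Nat.mod_lt n hm
  rw [hi, Nat.mul_succ] at hnm
  obtain ⟨s, hs⟩ : ∃ s, n = k % m + (m * i + s) := ⟨n - m * i - k % m, by omega⟩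
  have hij : i ≤ k / m := by
    have := Nat.div_le_div_right (c := m) hk
    omega
  have hint := D.integral_log_PpreN_le hε hδ hN hc hm hBm hB (k % m) i s (k / m) hx
  rw [← hs, Nat.mod_add_div] at hint
  have hgr := (D.iterate m).integral_le_growth hδ hij hx
  have hgi := hi₀ i (by omega)
  have hipos : (0 : ℝ) < i := by
    have : 0 < i := by omega
    exact_mod_cast this
  rw [one_div, inv_mul_lt_iff₀ hipos] at hgi
  have hrs : ((k % m : ℕ) : ℝ) + s ≤ 2 * m := by
    have : k % m + s ≤ 2 * m := by omega
    exact_mod_cast this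
  have him : (i : ℝ) * m ≤ n := by
    have : i * m ≤ n := by rw [Nat.mul_comm]; omega
    exact_mod_cast this
  have hin : (i : ℝ) ≤ n := by
    have : i ≤ n := (Nat.le_mul_of_pos_left i hm).trans (by omega)
    exact_mod_cast this
  have hKn : (K : ℝ) ≤ n := by exact_mod_cast hnK
  have t1 : (((k % m : ℕ) : ℝ) + s) * Real.log N ≤ 2 * m * Real.log N := by gcongr
  have t2 : (((k % m : ℕ) : ℝ) + s) * ∫ ω, b ω ∂P ≤ 2 * m * |∫ ω, b ω ∂P| :=
    (mul_le_mul_of_nonneg_left (le_abs_self _) (by positivity)).trans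
      (mul_le_mul_of_nonneg_right hrs (abs_nonneg _))
  have t3 : (i : ℝ) * m * (P.real B * Real.log N) ≤ n * 1 := by gcongr
  have t4 : (i : ℝ) * (M + 1) ≤ n * (M + 1) := by gcongr
  linarith

end Dominated

/-- First half of the power rule: `P_pre(T^m, S_m f, ε) ≤ m ⬝ P_pre(T, f, ε)` for all
    `ε > 0`, and hence `P_pre(T^m, S_m f) ≤ m ⬝ P_pre(T, f)`. -/
theorem PpreEps_pow_le
    {Ω : Type} [MeasurableSpace Ω] {X : Type} [MetricSpace X] [CompactSpace X]
    [MeasurableSpace X] [BorelSpace X]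
    (P : Measure Ω) [IsProbabilityMeasure P]
    -- `F` is complete, countably generated and separates points
    (hcomplete : ∀ s t : Set Ω, MeasurableSet t → P t = 0 → s ⊆ t → MeasurableSet s)
    [MeasurableSpace.CountablyGenerated Ω]
    (hsepPts : ∀ ω₁ ω₂ : Ω, ω₁ ≠ ω₂ → ∃ s : Set Ω, MeasurableSet s ∧ ω₁ ∈ s ∧ ω₂ ∉ s)
    -- `ϑ` is an invertible `P`-preserving transformation
    (ϑ : Ω → Ω) (hϑ : MeasurePreserving ϑ P P) (hϑbij : Function.Bijective ϑ)
    -- `E` is measurable with compact fibers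
    (E : Set (Ω × X)) (hE : MeasurableSet E) (hEcomp : ∀ ω, IsCompact (fiber E ω))
    -- `T` is a continuous bundle RDS on `E`
    (T : Ω → X → X) (hTmap : ∀ ω, MapsTo (T ω) (fiber E ω) (fiber E (ϑ ω)))
    (hTmeas : Measurable fun p : Ω × X => T p.1 p.2)
    (hTcont : ∀ᵐ ω ∂P, ContinuousOn (T ω) (fiber E ω))
    -- nonempty pre-image fibers
    (hfib : ∀ k : ℕ, ∀ x ∈ XE E, ∀ ω : Ω, (preFiber ϑ T E k x ω).Nonempty)
    -- `f ∈ L¹_E(Ω, C(X))`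
    (f : Ω → X → ℝ) (hfmeas : Measurable fun p : Ω × X => f p.1 p.2)
    (hfcont : ∀ ω, ContinuousOn (f ω) (fiber E ω))
    (hfint : Integrable (fun ω => sSup ((fun x => |f ω x|) '' fiber E ω)) P)
    (m : ℕ) (hm : 0 < m) :
    (∀ ε > (0 : ℝ),
      PpreEps P (ϑ^[m]) (fun ω => Tn ϑ T m ω) E (fun ω => Snf ϑ T f m ω) ε
        ≤ m * PpreEps P ϑ T E f ε) ∧
    Ppre P (ϑ^[m]) (fun ω => Tn ϑ T m ω) E (fun ω => Snf ϑ T f m ω)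
      ≤ m * Ppre P ϑ T E f := by
  have hle : ∀ ω, ∀ x ∈ fiber E ω, |f ω x| ≤ sSup ((fun x => |f ω x|) '' fiber E ω) :=
    fun ω x hx => le_csSup ((hEcomp ω).bddAbove_image (hfcont ω).abs) (mem_image_of_mem _ hx)
  have D : Dominated P ϑ T E f fun ω => sSup ((fun x => |f ω x|) '' fiber E ω) :=
    ⟨hϑ, hE, hTmap, hTmeas, hfib, hfmeas, hfint, hle⟩
  refine ⟨fun ε hε => D.PpreEps_iterate_le hε hm, ?_⟩
  by_cases hbdd : BddAbove {r : ℝ | ∃ ε > (0 : ℝ), r = PpreEps P ϑ T E f ε}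
  · refine csSup_le ⟨_, 1, one_pos, rfl⟩ ?_
    rintro _ ⟨ε, hε, rfl⟩
    refine (D.PpreEps_iterate_le hε hm).trans ?_
    gcongr
    exact le_csSup hbdd ⟨ε, hε, rfl⟩
  · have hbdd' : ¬BddAbove {r : ℝ | ∃ ε > (0 : ℝ),
        r = PpreEps P (ϑ^[m]) (fun ω => Tn ϑ T m ω) E (fun ω => Snf ϑ T f m ω) ε} := by
      rintro ⟨M, hM⟩
      refine hbdd ⟨max M 0 + 3, ?_⟩
      rintro _ ⟨ε, hε, rfl⟩
      exact D.PpreEps_le_of_forall_PpreEps_iterate_le hEcomp hTcont hm (le_max_right M 0)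
        (fun δ hδ => (hM ⟨δ, hδ, rfl⟩).trans (le_max_left M 0)) hε
    rw [Ppre, Ppre, Real.sSup_of_not_bddAbove hbdd, Real.sSup_of_not_bddAbove hbdd', mul_zero]

end PreImageRDS
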